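/- arXiv:2502.02622 — 4 statements merged into one kernel-verified Lean document; each statement's English description precedes it below -/
import Mathlib

section
/- Let P, Q > 0, R > 0 with R ≠ 1, and let N ≠ 0, λ, ν, M, ε₁, η, S₁prev, 𝓔prev be real numbers. Define P₁(u) = P/(P + Q·R^u) and the Hamiltonian H(u) = u·N·(1 − P₁(u)) + λ·(η·S₁prev + N·P₁(u)) + ν·(𝓔prev + M·ε₁·(η·S₁prev + N·P₁(u))). Then for every real u, the derivative of H at u is zero if and only if (Q·R^u)/P + (ln R)·u = (ln R)·λ + M·ε₁·(ln R)·ν − 1. -/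
open Real

/-- The derivative of the logit share `P / (P + Q·R^u)`. -/
theorem hasDerivAt_logit_share (P Q : ℝ) {R : ℝ} (hR : 0 < R) (u : ℝ)
    (hD : P + Q * R ^ u ≠ 0) :
    HasDerivAt (fun v : ℝ => P / (P + Q * R ^ v))
      (-(P * (Q * (R ^ u * log R))) / (P + Q * R ^ u) ^ 2) u := by
  have hpow : HasDerivAt (fun v : ℝ => R ^ v) (R ^ u * log R) u := by
    simpa using (hasStrictDerivAt_const_rpow hR u).hasDerivAt
  refine ((hasDerivAt_const u P).div ((hpow.const_mul Q).const_add P) hD).congr_deriv ?_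
  ring

/-- Stationarity of the reduced-order Hamiltonian is equivalent to the
transcendental equation `Q·R^u/P + (ln R)·u = (ln R)·λ + M·ε₁·(ln R)·ν − 1`. -/
theorem hamiltonian_stationarity (P Q R : ℝ) (hP : 0 < P) (hQ : 0 < Q) (hR : 0 < R)
    (hR1 : R ≠ 1) (N lam ν M ε₁ η S₁prev 𝓔prev : ℝ) (hN : N ≠ 0) :
    let P₁ : ℝ → ℝ := fun u => P / (P + Q * R ^ u)
    let H : ℝ → ℝ := fun u =>
      u * N * (1 - P₁ u) + lam * (η * S₁prev + N * P₁ u) +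
        ν * (𝓔prev + M * ε₁ * (η * S₁prev + N * P₁ u))
    ∀ u : ℝ, deriv H u = 0 ↔
      Q * R ^ u / P + Real.log R * u =
        Real.log R * lam + M * ε₁ * Real.log R * ν - 1 := by
  intro P₁ H u
  have hE : 0 < R ^ u := rpow_pos_of_pos hR u
  have hD : 0 < P + Q * R ^ u := by positivity
  have hP₁ : HasDerivAt P₁ (-(P * (Q * (R ^ u * log R))) / (P + Q * R ^ u) ^ 2) u :=
    hasDerivAt_logit_share P Q hR u hD.ne'
  have hstock := (hP₁.const_mul N).const_add (η * S₁prev)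
  have hH : HasDerivAt H (N * P * Q * R ^ u / (P + Q * R ^ u) ^ 2 *
      (Q * R ^ u / P + log R * u - (log R * lam + M * ε₁ * log R * ν - 1))) u := by
    refine HasDerivAt.congr_deriv ((((hasDerivAt_id u).mul_const N).mul (hP₁.const_sub 1)).add
      (hstock.const_mul lam) |>.add
      (((hstock.const_mul (M * ε₁)).const_add 𝓔prev).const_mul ν)) ?_
    simp only [P₁, id_eq]
    field_simp
    ring
  have hfactor : N * P * Q * R ^ u / (P + Q * R ^ u) ^ 2 ≠ 0 := by positivity
  rw [hH.deriv, mul_eq_zero_iff_left hfactor, sub_eq_zero]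
end

section
/- Let b be a real number and f : ℝ → ℝ a differentiable function such that f(a)·exp(f(a)) = −b·exp(a) for all real a. Then for every a with 1 + f(a) ≠ 0, the derivative of the function a ↦ 1/(1 + f(a)) at a equals −f(a)/(1 + f(a))³. -/
/-- A differentiable branch of `f(a)·e^{f(a)} = −b·e^a` satisfies `f'·(1 + f) = f`. -/
theorem deriv_mul_one_add_of_mul_exp_eq {b : ℝ} {f : ℝ → ℝ} (hf : Differentiable ℝ f)
    (hid : ∀ a : ℝ, f a * Real.exp (f a) = -b * Real.exp a) (a : ℝ) :
    deriv f a * (1 + f a) = f a := by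
  have hd : HasDerivAt f (deriv f a) a := (hf a).hasDerivAt
  have hl : HasDerivAt (fun x => f x * Real.exp (f x))
      (deriv f a * Real.exp (f a) + f a * (Real.exp (f a) * deriv f a)) a :=
    hd.mul hd.exp
  rw [funext hid] at hl
  have h := hl.unique ((Real.hasDerivAt_exp a).const_mul (-b))
  rw [← hid a] at h
  apply mul_right_cancel₀ (Real.exp_ne_zero (f a))
  linear_combination h

/-- Derivative of the optimal thermal share `a ↦ 1/(1 + f(a))` along the Lambert
branch `f(a)·e^{f(a)} = −b·e^a`: it equals `−f(a)/(1 + f(a))³`. -/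
theorem lambert_share_deriv (b : ℝ) (f : ℝ → ℝ) (hf : Differentiable ℝ f)
    (hid : ∀ a : ℝ, f a * Real.exp (f a) = -b * Real.exp a) :
    ∀ a : ℝ, 1 + f a ≠ 0 →
      deriv (fun a => 1 / (1 + f a)) a = -f a / (1 + f a) ^ 3 := by
  intro a ha
  have h := deriv_mul_one_add_of_mul_exp_eq hf hid a
  have hd := ((hf a).hasDerivAt.const_add 1).fun_inv ha
  simp only [one_div]
  rw [hd.deriv, div_eq_div_iff (pow_ne_zero 2 ha) (pow_ne_zero 3 ha)]
  linear_combination -(1 + f a) ^ 2 * h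
end

section
/- Let b be a real number and f : ℝ → ℝ a differentiable function such that f(a)·exp(f(a)) = −b·exp(a) for all real a. Then for every a with 1 + f(a) ≠ 0, the derivative of the function a ↦ (a·f(a) − f(a)²)/(1 + f(a)) at a equals f(a)·(1 + a)/(1 + f(a))³. -/
/-- Along a branch of `f(a)·e^{f(a)} = −b·e^a`, the derivative `f'` satisfies `f' (1 + f) = f`. -/
theorem lambert_branch_deriv_mul_one_add {b a f' : ℝ} {f : ℝ → ℝ} (hf : HasDerivAt f f' a)
    (hid : ∀ x : ℝ, f x * Real.exp (f x) = -b * Real.exp x) :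
    f' * (1 + f a) = f a := by
  have hl : HasDerivAt (fun x => f x * Real.exp (f x))
      (f' * Real.exp (f a) + f a * (Real.exp (f a) * f')) a := hf.mul hf.exp
  have hr : HasDerivAt (fun x => f x * Real.exp (f x)) (-b * Real.exp a) a := by
    rw [funext hid]
    exact (Real.hasDerivAt_exp a).const_mul (-b)
  have h := hl.unique hr
  rw [← hid a] at h
  apply mul_right_cancel₀ (Real.exp_ne_zero (f a))
  linear_combination h

/-- Derivative of `a ↦ (a·f(a) − f(a)²)/(1 + f(a))` along the Lambert branch
`f(a)·e^{f(a)} = −b·e^a`: it equals `f(a)·(1 + a)/(1 + f(a))³`. -/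
theorem lambert_expenditure_deriv (b : ℝ) (f : ℝ → ℝ) (hf : Differentiable ℝ f)
    (hid : ∀ a : ℝ, f a * Real.exp (f a) = -b * Real.exp a) :
    ∀ a : ℝ, 1 + f a ≠ 0 →
      deriv (fun a => (a * f a - f a ^ 2) / (1 + f a)) a =
        f a * (1 + a) / (1 + f a) ^ 3 := by
  intro a ha
  have hfa := (hf a).hasDerivAt
  have hf' := lambert_branch_deriv_mul_one_add hfa hid
  have h := (((hasDerivAt_id' a).fun_mul hfa).fun_sub (hfa.fun_pow 2)).fun_div
    (hfa.const_add 1) ha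
  rw [h.deriv, eq_div_of_mul_eq ha hf']
  field_simp
  ring
end

section
/- Let b be a real number and f : ℝ → ℝ a differentiable function such that f(a)·exp(f(a)) = −b·exp(a) for all real a. If f(a) > 0 at some point a, then the derivative of a ↦ 1/(1 + f(a)) at a is strictly negative; and if moreover a > −1, the derivative of a ↦ (a·f(a) − f(a)²)/(1 + f(a)) at a is strictly positive. -/
/-- Logarithmic differentiation of `f(a) e^{f(a)} = -b e^a` gives `f' (1 + f) = f`. -/
lemma lambert_deriv_mul_one_add (b : ℝ) (f : ℝ → ℝ) (hf : Differentiable ℝ f)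
    (hid : ∀ a : ℝ, f a * Real.exp (f a) = -b * Real.exp a) (a : ℝ) :
    deriv f a * (1 + f a) = f a := by
  have hd := (hf a).hasDerivAt
  have hl := hd.mul hd.exp
  have hr := (Real.hasDerivAt_exp a).const_mul (-b)
  have he : f * (fun x => Real.exp (f x)) = fun x => -b * Real.exp x := funext hid
  rw [he] at hl
  have h := hl.unique hr
  rw [← hid a] at h
  apply mul_right_cancel₀ (Real.exp_ne_zero (f a))
  linear_combination h

/-- Sign of the derivatives along the Lambert branch: where `f(a) > 0`, the share
`1/(1 + f(a))` is strictly decreasing and, if moreover `a > −1`, the expenditure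
term `(a·f(a) − f(a)²)/(1 + f(a))` is strictly increasing. -/
theorem lambert_deriv_signs (b : ℝ) (f : ℝ → ℝ) (hf : Differentiable ℝ f)
    (hid : ∀ a : ℝ, f a * Real.exp (f a) = -b * Real.exp a) :
    ∀ a : ℝ, 0 < f a →
      deriv (fun a => 1 / (1 + f a)) a < 0 ∧
        (-1 < a → 0 < deriv (fun a => (a * f a - f a ^ 2) / (1 + f a)) a) := by
  intro a ha
  have hpos : 0 < 1 + f a := by linarith
  have hd : HasDerivAt f (f a / (1 + f a)) a := by
    rw [← eq_div_of_mul_eq hpos.ne' (lambert_deriv_mul_one_add b f hf hid a)]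
    exact (hf a).hasDerivAt
  constructor
  · have h : HasDerivAt (fun a => 1 / (1 + f a)) (-(f a / (1 + f a) ^ 3)) a := by
      refine ((hasDerivAt_const a (1 : ℝ)).fun_div (hd.const_add 1) hpos.ne').congr_deriv ?_
      field_simp
      ring
    rw [h.deriv, neg_lt_zero]
    positivity
  · intro ha1
    have h : HasDerivAt (fun a => (a * f a - f a ^ 2) / (1 + f a))
        (f a * (1 + a) / (1 + f a) ^ 3) a := by
      refine ((((hasDerivAt_id' a).fun_mul hd).fun_sub (hd.fun_pow 2)).fun_div
        (hd.const_add 1) hpos.ne').congr_deriv ?_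
      field_simp
      ring
    rw [h.deriv]
    have ha2 : 0 < 1 + a := by linarith
    positivity
end
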